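/- arXiv:1604.07707 — 4 statements merged into one kernel-verified Lean document; each statement's English description precedes it below -/
import Mathlib

section
/- (Monotonicity of finite-volume Gibbs measures in the boundary condition.) Let d ≥ 1, β > 0 and K : ℤ^d → ℝ symmetric with finite range and K ≥ 0. Let Λ ⊂ ℤ^d be finite and τ₁, τ₂ ∈ {−1,+1}^{ℤ^d} with τ₁ ≼ τ₂ (pointwise). Then μ_Λ^{τ₁} ≼ μ_Λ^{τ₂} in stochastic order: for every nondecreasing function f on {−1,+1}^Λ, Σ_σ f(σ) μ_Λ^{τ₁}(σ) ≤ Σ_σ f(σ) μ_Λ^{τ₂}(σ). -/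
open MeasureTheory ProbabilityTheory

namespace ClassC

/-- Sites of the lattice `ℤ^d`. -/
abbrev Site (d : ℕ) := Fin d → ℤ

/-- The spin space `{-1,+1} ⊂ ℝ`. -/
abbrev Spin : Type := ({-1, 1} : Finset ℝ)

/-- The spin `+1`. -/
def sPlus : Spin := ⟨1, by simp⟩
/-- The spin `-1`. -/
def sMinus : Spin := ⟨-1, by simp⟩

/-- Configuration space `{-1,+1}^{ℤ^d}`. -/
abbrev Config (d : ℕ) := Site d → Spin

variable {d : ℕ}

/-- The constant configuration `+1` (respectively `-1`). -/
def cPlus (d : ℕ) : Config d := fun _ => sPlus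
def cMinus (d : ℕ) : Config d := fun _ => sMinus

/-- `K` is symmetric with finite range `R`: `K(k) = K(-k)` and `K(k) = 0` as soon as
`Σᵢ |kᵢ| > R`. -/
def SymmFiniteRange (K : Site d → ℝ) (R : ℕ) : Prop :=
  (∀ k, K (-k) = K k) ∧ ∀ k : Site d, (R : ℤ) < ∑ i, |k i| → K k = 0

/-- The ball `B_L = {k : Σᵢ |kᵢ| ≤ L}` for the ℓ¹ norm on `ℤ^d`. -/
noncomputable def ball (d L : ℕ) : Finset (Site d) :=
  (Finset.Icc (fun _ => -(L : ℤ)) (fun _ => (L : ℤ))).filter fun k => ∑ i, |k i| ≤ (L : ℤ)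

lemma zero_mem_ball (d L : ℕ) : (0 : Site d) ∈ ball d L := by
  simp [ball, Finset.mem_filter, Finset.mem_Icc, Pi.le_def]

/-- `patch Λ σ τ` is the configuration `σ_Λ τ_{Λᶜ}`. -/
def patch (Λ : Finset (Site d)) (σ : ↥Λ → Spin) (τ : Config d) : Config d :=
  fun j => if h : j ∈ Λ then σ ⟨j, h⟩ else τ j

/-- The local mean field `β Σ_{k'} K(k'-k) η_{k'}` at site `k`. -/
noncomputable def field (β : ℝ) (K : Site d → ℝ) (k : Site d) (η : Config d) : ℝ :=
  β * ∑ᶠ k' : Site d, K (k' - k) * (η k' : ℝ)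

/-- The class-C updating rule `p_k(s|η) = ½ (1 + s tanh(β Σ_{k'} K(k'-k) η_{k'}))`. -/
noncomputable def upd (β : ℝ) (K : Site d → ℝ) (k : Site d) (η : Config d) (s : Spin) : ℝ :=
  (1 + (s : ℝ) * Real.tanh (field β K k η)) / 2

/-- Transition probabilities of the finite volume class-C dynamics `P_Λ^τ` on
`{-1,+1}^Λ`: `P_Λ^τ(σ|η) = Π_{k∈Λ} p_k(σ_k | η_Λ τ_{Λᶜ})`. -/
noncomputable def fvKer (β : ℝ) (K : Site d → ℝ) (Λ : Finset (Site d)) (τ : Config d)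
    (η σ : ↥Λ → Spin) : ℝ :=
  ∏ k : ↥Λ, upd β K (k : Site d) (patch Λ η τ) (σ k)

/-- The unnormalised weight of the finite volume reversible measure `ν_Λ^τ`:
`Π_{k∈Λ} cosh(β Σ_j K(k-j) σ̃_j) exp(β σ_k Σ_{j∈Λᶜ} K(k-j) τ_j)` with `σ̃ = σ_Λ τ_{Λᶜ}`. -/
noncomputable def nuWeight (β : ℝ) (K : Site d → ℝ) (Λ : Finset (Site d)) (τ : Config d)
    (σ : ↥Λ → Spin) : ℝ :=
  ∏ k : ↥Λ,
    Real.cosh (β * ∑ᶠ j : Site d, K ((k : Site d) - j) * ((patch Λ σ τ) j : ℝ)) *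
      Real.exp (β * (σ k : ℝ) * ∑ᶠ j ∈ {j : Site d | j ∉ Λ}, K ((k : Site d) - j) * (τ j : ℝ))

/-- The finite volume measure `ν_Λ^τ` (normalised weight). -/
noncomputable def nuFV (β : ℝ) (K : Site d → ℝ) (Λ : Finset (Site d)) (τ : Config d)
    (σ : ↥Λ → Spin) : ℝ :=
  nuWeight β K Λ τ σ / ∑ σ', nuWeight β K Λ τ σ'

/-- The finite volume Hamiltonian `Σ_{A ∩ Λ ≠ ∅} φ_A(σ_Λ τ_{Λᶜ})` for the potential `φ`
canonically associated to the dynamics: `φ_{U_k} = - log cosh(β Σ_j K(k-j) σ_j)` on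
`U_k = {j : K(k-j) ≠ 0}` and `φ_A = 0` otherwise; the sum over `A` meeting `Λ` is the
sum over those `k` with `U_k ∩ Λ ≠ ∅`. -/
noncomputable def ham (β : ℝ) (K : Site d → ℝ) (Λ : Finset (Site d)) (τ : Config d)
    (σ : ↥Λ → Spin) : ℝ :=
  ∑ᶠ (k : Site d) (_ : ∃ j ∈ Λ, K (k - j) ≠ 0),
    -Real.log (Real.cosh (β * ∑ᶠ j : Site d, K (k - j) * ((patch Λ σ τ) j : ℝ)))

/-- The finite volume Gibbs measure `μ_Λ^τ = exp(-H_Λ^τ)/Z_Λ^τ`. -/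
noncomputable def gibbsFV (β : ℝ) (K : Site d → ℝ) (Λ : Finset (Site d)) (τ : Config d)
    (σ : ↥Λ → Spin) : ℝ :=
  Real.exp (-ham β K Λ τ σ) / ∑ σ', Real.exp (-ham β K Λ τ σ')

/-- Mean value of the spin at the origin under a finite volume (probability) weight. -/
noncomputable def atZero {Λ : Finset (Site d)} (h : (0 : Site d) ∈ Λ)
    (ν : (↥Λ → Spin) → ℝ) : ℝ :=
  ∑ σ, ν σ * ((σ ⟨0, h⟩ : ℝ))

/-- The inner boundary `∂ᵢΔ = {k ∈ Δ : U_k ∩ Δᶜ ≠ ∅}`, `U_k = {j : K(k-j) ≠ 0}`. -/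
def ibdry (K : Site d → ℝ) (Δ : Finset (Site d)) : Set (Site d) :=
  {k | k ∈ Δ ∧ ∃ j ∉ Δ, K (k - j) ≠ 0}

end ClassC

namespace ClassC

lemma cosh_mul_le {a b c e : ℝ} (h : a + b = c + e) (hca : c ≤ a) (hcb : c ≤ b) :
    Real.cosh a * Real.cosh b ≤ Real.cosh c * Real.cosh e := by
  have key : ∀ x y : ℝ, Real.cosh x * Real.cosh y = (Real.cosh (x + y) + Real.cosh (x - y)) / 2 := by
    intro x y
    rw [Real.cosh_add, Real.cosh_sub]; ring
  rw [key, key, h]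
  have : Real.cosh (a - b) ≤ Real.cosh (c - e) := by
    rw [Real.cosh_le_cosh, abs_le, abs_of_nonpos (by linarith)]
    constructor <;> linarith
  linarith

lemma finite_supp {d : ℕ} {K : Site d → ℝ} {R : ℕ} (hK : SymmFiniteRange K R) :
    {k : Site d | K k ≠ 0}.Finite := by
  apply (ball d R).finite_toSet.subset
  intro k hk
  have h1 : ∑ i, |k i| ≤ (R : ℤ) := by
    by_contra h
    exact hk (hK.2 k (not_le.mp h))
  have h2 : ∀ i, |k i| ≤ (R : ℤ) := fun i =>
    (Finset.single_le_sum (f := fun i => |k i|) (fun i _ => abs_nonneg _) (Finset.mem_univ i)).trans h1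
  simp only [ball, Finset.coe_filter, Finset.mem_Icc, Pi.le_def, Set.mem_ofPred_eq]
  exact ⟨⟨fun i => (abs_le.mp (h2 i)).1, fun i => (abs_le.mp (h2 i)).2⟩, h1⟩

lemma finite_supp_sub {d : ℕ} {K : Site d → ℝ} {R : ℕ} (hK : SymmFiniteRange K R) (k : Site d) :
    {j : Site d | K (k - j) ≠ 0}.Finite :=
  (finite_supp hK).preimage (f := fun j => k - j) (sub_right_injective.injOn)

lemma finite_index {d : ℕ} {K : Site d → ℝ} {R : ℕ} (hK : SymmFiniteRange K R)
    (Λ : Finset (Site d)) : {k : Site d | ∃ j ∈ Λ, K (k - j) ≠ 0}.Finite := by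
  have : {k : Site d | ∃ j ∈ Λ, K (k - j) ≠ 0} = ⋃ j ∈ Λ, {k | K (k - j) ≠ 0} := by
    ext; simp
  rw [this]
  exact Λ.finite_toSet.biUnion fun j _ =>
    (finite_supp hK).preimage (f := fun k => k - j) (sub_left_injective.injOn)

lemma fsum_eq {d : ℕ} {K : Site d → ℝ} {R : ℕ} (hK : SymmFiniteRange K R) (k : Site d)
    (η : Config d) : ∑ᶠ j : Site d, K (k - j) * (η j : ℝ) =
      ∑ j ∈ (finite_supp_sub hK k).toFinset, K (k - j) * (η j : ℝ) := by
  apply finsum_eq_sum_of_support_subset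
  intro j hj
  simp only [Function.mem_support] at hj
  simpa using left_ne_zero_of_mul hj

lemma weight_eq {d : ℕ} {K : Site d → ℝ} {R : ℕ} (hK : SymmFiniteRange K R) (β : ℝ)
    (Λ : Finset (Site d)) (τ : Config d) (σ : ↥Λ → Spin) :
    Real.exp (-ham β K Λ τ σ) = ∏ k ∈ (finite_index hK Λ).toFinset,
      Real.cosh (β * ∑ᶠ j : Site d, K (k - j) * ((patch Λ σ τ) j : ℝ)) := by
  have h := finsum_mem_eq_finite_toFinset_sum (fun k : Site d =>
    -Real.log (Real.cosh (β * ∑ᶠ j : Site d, K (k - j) * ((patch Λ σ τ) j : ℝ))))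
    (finite_index hK Λ)
  simp only [Set.mem_ofPred_eq] at h
  rw [ham, h, ← Finset.sum_neg_distrib, Real.exp_sum]
  refine Finset.prod_congr rfl fun k _ => ?_
  rw [neg_neg, Real.exp_log (Real.cosh_pos _)]

lemma patch_cases {d : ℕ} (Λ : Finset (Site d)) (τ₁ τ₂ : Config d) (hτ : τ₁ ≤ τ₂)
    (σ η : ↥Λ → Spin) (j : Site d) :
    ((patch Λ σ τ₁ j : ℝ) + (patch Λ η τ₂ j : ℝ) =
      (patch Λ (σ ⊓ η) τ₁ j : ℝ) + (patch Λ (σ ⊔ η) τ₂ j : ℝ)) ∧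
    ((patch Λ (σ ⊓ η) τ₁ j : ℝ) ≤ (patch Λ σ τ₁ j : ℝ)) ∧
    ((patch Λ (σ ⊓ η) τ₁ j : ℝ) ≤ (patch Λ η τ₂ j : ℝ)) := by
  unfold patch
  by_cases h : j ∈ Λ
  · simp only [h, dif_pos, Pi.inf_apply, Pi.sup_apply]
    rcases le_total (σ ⟨j, h⟩) (η ⟨j, h⟩) with h' | h'
    · rw [inf_eq_left.mpr h', sup_eq_right.mpr h']
      exact ⟨rfl, le_rfl, h'⟩
    · rw [inf_eq_right.mpr h', sup_eq_left.mpr h']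
      exact ⟨add_comm _ _, h', le_rfl⟩
  · simp only [h, dif_neg, not_false_iff]
    exact ⟨trivial, le_rfl, hτ j⟩

lemma weight_holley {d : ℕ} {K : Site d → ℝ} {R : ℕ} (hK : SymmFiniteRange K R) {β : ℝ}
    (hβ : 0 < β) (hKpos : ∀ k, 0 ≤ K k)
    (Λ : Finset (Site d)) (τ₁ τ₂ : Config d) (hτ : τ₁ ≤ τ₂) (σ η : ↥Λ → Spin) :
    Real.exp (-ham β K Λ τ₁ σ) * Real.exp (-ham β K Λ τ₂ η) ≤
      Real.exp (-ham β K Λ τ₁ (σ ⊓ η)) * Real.exp (-ham β K Λ τ₂ (σ ⊔ η)) := by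
  simp only [weight_eq hK, ← Finset.prod_mul_distrib]
  refine Finset.prod_le_prod (fun k _ => by positivity) fun k _ => ?_
  simp only [fsum_eq hK]
  apply cosh_mul_le
  · rw [← mul_add, ← mul_add, ← Finset.sum_add_distrib, ← Finset.sum_add_distrib]
    congr 1
    refine Finset.sum_congr rfl fun j _ => ?_
    rw [← mul_add, ← mul_add, (patch_cases Λ τ₁ τ₂ hτ σ η j).1]
  · refine mul_le_mul_of_nonneg_left (Finset.sum_le_sum fun j _ => ?_) hβ.le
    exact mul_le_mul_of_nonneg_left (patch_cases Λ τ₁ τ₂ hτ σ η j).2.1 (hKpos _)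
  · refine mul_le_mul_of_nonneg_left (Finset.sum_le_sum fun j _ => ?_) hβ.le
    exact mul_le_mul_of_nonneg_left (patch_cases Λ τ₁ τ₂ hτ σ η j).2.2 (hKpos _)

lemma Z_pos {d : ℕ} (β : ℝ) (K : Site d → ℝ) (Λ : Finset (Site d)) (τ : Config d) :
    0 < ∑ σ', Real.exp (-ham β K Λ τ σ') :=
  Finset.sum_pos (fun _ _ => Real.exp_pos _) ⟨fun _ => sPlus, Finset.mem_univ _⟩

lemma gibbs_nonneg {d : ℕ} (β : ℝ) (K : Site d → ℝ) (Λ : Finset (Site d)) (τ : Config d) :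
    0 ≤ gibbsFV β K Λ τ := fun _ => div_nonneg (Real.exp_pos _).le (Z_pos β K Λ τ).le

lemma gibbs_sum {d : ℕ} (β : ℝ) (K : Site d → ℝ) (Λ : Finset (Site d)) (τ : Config d) :
    ∑ σ, gibbsFV β K Λ τ σ = 1 := by
  simp only [gibbsFV]
  rw [← Finset.sum_div, div_self (Z_pos β K Λ τ).ne']

end ClassC

open ClassC in
/-- monotonicity of the finite-volume Gibbs measures in the boundary
condition: for `K ≥ 0` and `τ₁ ≼ τ₂`, `μ_Λ^{τ₁} ≼ μ_Λ^{τ₂}` in stochastic order. -/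
theorem stmt_11
    (d : ℕ) (hd : 1 ≤ d) (β : ℝ) (hβ : 0 < β)
    (K : Site d → ℝ) (R : ℕ) (hR : 1 ≤ R) (hK : SymmFiniteRange K R)
    (hKpos : ∀ k, 0 ≤ K k)
    (Λ : Finset (Site d)) (τ₁ τ₂ : Config d) (hτ : τ₁ ≤ τ₂) :
    ∀ f : (↥Λ → Spin) → ℝ, Monotone f →
      ∑ σ, gibbsFV β K Λ τ₁ σ * f σ ≤ ∑ σ, gibbsFV β K Λ τ₂ σ * f σ := by
  intro f hf
  set c : ℝ := ∑ σ, |f σ| with hc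
  have hpos : 0 ≤ fun σ => f σ + c := by
    intro σ
    have h1 : |f σ| ≤ c :=
      Finset.single_le_sum (f := fun σ => |f σ|) (fun i _ => abs_nonneg _) (Finset.mem_univ σ)
    have h2 := neg_abs_le (f σ)
    show 0 ≤ f σ + c
    linarith
  have hmono : Monotone fun σ => f σ + c := fun a b hab => by
    have := hf hab
    show f a + c ≤ f b + c
    linarith
  have key := holley (μ := fun σ => f σ + c) (f := gibbsFV β K Λ τ₁) (g := gibbsFV β K Λ τ₂)
    hpos (gibbs_nonneg β K Λ τ₁) (gibbs_nonneg β K Λ τ₂) hmono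
    (by rw [gibbs_sum, gibbs_sum])
    (by
      intro σ η
      simp only [gibbsFV]
      rw [div_mul_div_comm, div_mul_div_comm]
      exact div_le_div_of_nonneg_right (weight_holley hK hβ hKpos Λ τ₁ τ₂ hτ σ η)
        (mul_pos (Z_pos β K Λ τ₁) (Z_pos β K Λ τ₂)).le)
  simp only [add_mul, Finset.sum_add_distrib, ← Finset.mul_sum, gibbs_sum] at key
  simp only [mul_comm (gibbsFV _ _ _ _ _)]
  linarith
end

section
/- (Inequality (CondPlus): monotone behaviour of the conditioned finite-volume stationary measures with extremal boundary conditions.) Let d ≥ 1, β > 0 and K : ℤ^d → ℝ symmetric with finite range and K ≥ 0. Let Λ ⊂ Λ' be finite subsets of ℤ^d. Then for every configuration σ_{Λ'∖Λ} ∈ {−1,+1}^{Λ'∖Λ}: ν_{Λ'}^{+}( (·)_Λ | σ_{Λ'∖Λ} ) ≼ ν_Λ^{+} and ν_{Λ'}^{−}( (·)_Λ | σ_{Λ'∖Λ} ) ≽ ν_Λ^{−} in stochastic order on {−1,+1}^Λ, where the superscript + (resp. −) denotes the constant boundary condition +1 (resp. −1). -/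
open MeasureTheory ProbabilityTheory

namespace ClassC

variable {d : ℕ}

lemma holley_norm {α : Type*} [DistribLattice α] [Fintype α] [Nonempty α]
    (w1 w2 f : α → ℝ) (h1 : ∀ a, 0 < w1 a) (h2 : ∀ a, 0 < w2 a) (hf : Monotone f)
    (h : ∀ a b, w1 a * w2 b ≤ w1 (a ⊓ b) * w2 (a ⊔ b)) :
    ∑ a, w1 a / (∑ c, w1 c) * f a ≤ ∑ a, w2 a / (∑ c, w2 c) * f a := by
  have hs1 : 0 < ∑ c, w1 c := Finset.sum_pos (fun a _ => h1 a) Finset.univ_nonempty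
  have hs2 : 0 < ∑ c, w2 c := Finset.sum_pos (fun a _ => h2 a) Finset.univ_nonempty
  have e1 : ∑ a, w1 a / (∑ c, w1 c) = 1 := by
    rw [← Finset.sum_div, div_self hs1.ne']
  have e2 : ∑ a, w2 a / (∑ c, w2 c) = 1 := by
    rw [← Finset.sum_div, div_self hs2.ne']
  let M : ℝ := ∑ a, |f a|
  have hM : ∀ a, 0 ≤ f a + M := by
    intro a
    have : |f a| ≤ M := Finset.single_le_sum (f := fun a => |f a|)
      (fun i _ => abs_nonneg _) (Finset.mem_univ a)
    linarith [neg_abs_le (f a)]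
  have key := holley (f := fun a => w1 a / (∑ c, w1 c)) (g := fun a => w2 a / (∑ c, w2 c))
    (μ := fun a => f a + M) (fun a => hM a)
    (fun a => (div_pos (h1 a) hs1).le) (fun a => (div_pos (h2 a) hs2).le)
    (fun a b hab => by have := hf hab; simp only; linarith) (by rw [e1, e2])
    (fun a b => by
      rw [div_mul_div_comm, div_mul_div_comm]
      exact div_le_div_of_nonneg_right (h a b) (mul_pos hs1 hs2).le)
  have r : ∀ w : α → ℝ, ∑ a, w a = 1 → ∑ a, (f a + M) * w a = ∑ a, w a * f a + M := by
    intro w hw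
    calc _ = ∑ a, (w a * f a + M * w a) := Finset.sum_congr rfl fun _ _ => by ring
      _ = _ := by rw [Finset.sum_add_distrib, ← Finset.mul_sum, hw, mul_one]
  rw [r _ e1, r _ e2] at key
  linarith

lemma cosh_mul_le_s12 {u v p q : ℝ} (hs : u + v = p + q) (hu : p ≤ u) (hv : p ≤ v) :
    Real.cosh u * Real.cosh v ≤ Real.cosh p * Real.cosh q := by
  have e : ∀ x y : ℝ, Real.cosh x * Real.cosh y = (Real.cosh (x + y) + Real.cosh (x - y)) / 2 := by
    intro x y; rw [Real.cosh_add, Real.cosh_sub]; ring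
  rw [e u v, e p q, hs]
  have : Real.cosh (u - v) ≤ Real.cosh (p - q) := by
    rw [Real.cosh_le_cosh]
    rw [abs_le, abs_of_nonpos (by linarith)]
    constructor <;> linarith
  linarith

lemma cosh_le_exp {x t : ℝ} (ht : 0 ≤ t) :
    Real.cosh (x + t) ≤ Real.cosh x * Real.exp t := by
  rw [Real.cosh_eq, Real.cosh_eq]
  have : Real.exp (-(x+t)) ≤ Real.exp (-x) * Real.exp t := by
    rw [← Real.exp_add]; apply Real.exp_le_exp.2; linarith
  have h2 : Real.exp (x + t) = Real.exp x * Real.exp t := Real.exp_add _ _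
  linarith

/-- Weight as a function of a real-valued configuration, with a finite window `T`. -/
noncomputable def rW (β : ℝ) (K : Site d → ℝ) (T Λ : Finset (Site d)) (η : Site d → ℝ) : ℝ :=
  (∏ k ∈ Λ, Real.cosh (β * ∑ j ∈ T, K (k - j) * η j)) *
    Real.exp (∑ k ∈ Λ, β * η k * ∑ j ∈ T \ Λ, K (k - j))

lemma rW_le (β : ℝ) (hβ : 0 < β) (K : Site d → ℝ) (hs : ∀ k, K (-k) = K k)
    (hK : ∀ k, 0 ≤ K k) (T Λ Λ' : Finset (Site d)) (h1 : Λ ⊆ Λ') (h2 : Λ' ⊆ T)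
    (u v p q : Site d → ℝ) (hsum : ∀ j, u j + v j = p j + q j)
    (hu : ∀ j, p j ≤ u j) (hv : ∀ j, p j ≤ v j) (hout : ∀ j, j ∉ Λ → u j = p j) :
    rW β K T Λ' u * rW β K T Λ v ≤ rW β K T Λ' p * rW β K T Λ q := by
  have mono : ∀ (x y : Site d → ℝ), (∀ j, x j ≤ y j) → ∀ k,
      β * ∑ j ∈ T, K (k - j) * x j ≤ β * ∑ j ∈ T, K (k - j) * y j := by
    intro x y hxy k
    refine mul_le_mul_of_nonneg_left (Finset.sum_le_sum fun j _ => ?_) hβ.le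
    exact mul_le_mul_of_nonneg_left (hxy j) (hK _)
  let F : (Site d → ℝ) → Site d → ℝ := fun x k => β * ∑ j ∈ T, K (k - j) * x j
  have hFsum : ∀ k, F u k + F v k = F p k + F q k := by
    intro k
    simp only [F, ← mul_add, ← Finset.sum_add_distrib, hsum]
  have A : (∏ k ∈ Λ, Real.cosh (F u k)) * (∏ k ∈ Λ, Real.cosh (F v k)) ≤
      (∏ k ∈ Λ, Real.cosh (F p k)) * (∏ k ∈ Λ, Real.cosh (F q k)) := by
    rw [← Finset.prod_mul_distrib, ← Finset.prod_mul_distrib]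
    refine Finset.prod_le_prod (fun k _ => by positivity) fun k _ => ?_
    exact cosh_mul_le_s12 (hFsum k) (mono _ _ hu k) (mono _ _ hv k)
  have B : (∏ k ∈ Λ' \ Λ, Real.cosh (F u k)) ≤
      (∏ k ∈ Λ' \ Λ, Real.cosh (F p k)) * Real.exp (∑ k ∈ Λ' \ Λ, (F u k - F p k)) := by
    rw [Real.exp_sum, ← Finset.prod_mul_distrib]
    refine Finset.prod_le_prod (fun k _ => by positivity) fun k _ => ?_
    have := cosh_le_exp (x := F p k) (t := F u k - F p k) (sub_nonneg.2 (mono _ _ hu k))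
    simpa using this
  have C : (∑ k ∈ Λ' \ Λ, (F u k - F p k)) + (∑ k ∈ Λ', β * u k * ∑ j ∈ T \ Λ', K (k - j))
        + (∑ k ∈ Λ, β * v k * ∑ j ∈ T \ Λ, K (k - j))
      = (∑ k ∈ Λ', β * p k * ∑ j ∈ T \ Λ', K (k - j))
        + (∑ k ∈ Λ, β * q k * ∑ j ∈ T \ Λ, K (k - j)) := by
    have c1 : ∀ k, F u k - F p k = ∑ j ∈ Λ, β * K (k - j) * (u j - p j) := by
      intro k
      simp only [F]
      rw [← mul_sub, ← Finset.sum_sub_distrib, Finset.mul_sum]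
      symm
      refine (Finset.sum_subset (h1.trans h2) fun j _ hj => ?_).trans
        (Finset.sum_congr rfl fun j _ => by ring)
      rw [hout j hj]; ring
    have c2 : (∑ k ∈ Λ', β * u k * ∑ j ∈ T \ Λ', K (k - j)) -
        (∑ k ∈ Λ', β * p k * ∑ j ∈ T \ Λ', K (k - j)) =
        ∑ k ∈ Λ, β * (u k - p k) * ∑ j ∈ T \ Λ', K (k - j) := by
      rw [← Finset.sum_sub_distrib]
      symm
      refine (Finset.sum_subset h1 fun j _ hj => ?_).trans
        (Finset.sum_congr rfl fun j _ => by ring)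
      rw [hout j hj]; ring
    have c3 : (∑ k ∈ Λ, β * q k * ∑ j ∈ T \ Λ, K (k - j)) -
        (∑ k ∈ Λ, β * v k * ∑ j ∈ T \ Λ, K (k - j)) =
        ∑ k ∈ Λ, β * (u k - p k) * ∑ j ∈ T \ Λ, K (k - j) := by
      rw [← Finset.sum_sub_distrib]
      refine Finset.sum_congr rfl fun k _ => ?_
      have : u k - p k = q k - v k := by linarith [hsum k]
      rw [this]; ring
    have c4 : ∀ k, ∑ j ∈ T \ Λ, K (k - j) = ∑ j ∈ T \ Λ', K (k - j) + ∑ j ∈ Λ' \ Λ, K (k - j) := by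
      intro k
      rw [← Finset.sum_union]
      · refine Finset.sum_congr ?_ fun _ _ => rfl
        ext j
        have a1 := @h1 j
        have a2 := @h2 j
        simp only [Finset.mem_sdiff, Finset.mem_union]
        tauto
      · rw [Finset.disjoint_left]
        intro j
        simp only [Finset.mem_sdiff]
        tauto
    have c5 : (∑ k ∈ Λ' \ Λ, (F u k - F p k)) =
        ∑ k ∈ Λ, β * (u k - p k) * ∑ j ∈ Λ' \ Λ, K (k - j) := by
      simp only [c1]
      rw [Finset.sum_comm]
      refine Finset.sum_congr rfl fun k _ => ?_
      rw [Finset.mul_sum]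
      refine Finset.sum_congr rfl fun j _ => ?_
      rw [← hs (k - j), neg_sub]; ring
    have c6 : ∑ k ∈ Λ, β * (u k - p k) * ∑ j ∈ T \ Λ, K (k - j) =
        ∑ k ∈ Λ, β * (u k - p k) * ∑ j ∈ T \ Λ', K (k - j) +
        ∑ k ∈ Λ, β * (u k - p k) * ∑ j ∈ Λ' \ Λ, K (k - j) := by
      rw [← Finset.sum_add_distrib]
      refine Finset.sum_congr rfl fun k _ => ?_
      rw [c4]; ring
    linarith
  have hsplit : ∀ x, ∏ k ∈ Λ', Real.cosh (F x k) =
      (∏ k ∈ Λ' \ Λ, Real.cosh (F x k)) * ∏ k ∈ Λ, Real.cosh (F x k) :=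
    fun x => (Finset.prod_sdiff h1).symm
  have hpos : ∀ (S : Finset (Site d)) x, 0 < ∏ k ∈ S, Real.cosh (F x k) :=
    fun S x => Finset.prod_pos fun k _ => Real.cosh_pos _
  unfold rW
  change (∏ k ∈ Λ', Real.cosh (F u k)) * _ * ((∏ k ∈ Λ, Real.cosh (F v k)) * _) ≤
    (∏ k ∈ Λ', Real.cosh (F p k)) * _ * ((∏ k ∈ Λ, Real.cosh (F q k)) * _)
  rw [hsplit u, hsplit p]
  have D := mul_le_mul B A (mul_pos (hpos _ _) (hpos _ _)).le
    (mul_pos (hpos _ _) (Real.exp_pos _)).le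
  set e1 := ∑ k ∈ Λ' \ Λ, (F u k - F p k)
  set e2 := (∑ k ∈ Λ', β * u k * ∑ j ∈ T \ Λ', K (k - j))
  set e3 := (∑ k ∈ Λ, β * v k * ∑ j ∈ T \ Λ, K (k - j))
  set e4 := (∑ k ∈ Λ', β * p k * ∑ j ∈ T \ Λ', K (k - j))
  set e5 := (∑ k ∈ Λ, β * q k * ∑ j ∈ T \ Λ, K (k - j))
  have E := mul_le_mul_of_nonneg_right D (Real.exp_pos (e2 + e3)).le
  have G : Real.exp e1 * Real.exp (e2 + e3) = Real.exp e4 * Real.exp e5 := by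
    rw [← Real.exp_add, ← Real.exp_add, ← add_assoc, C]
  rw [Real.exp_add] at E G
  calc _ = _ := by ring
    _ ≤ _ := E
    _ = (∏ k ∈ Λ' \ Λ, Real.cosh (F p k)) * ((∏ k ∈ Λ, Real.cosh (F p k)) *
          ∏ k ∈ Λ, Real.cosh (F q k)) *
          (Real.exp e1 * (Real.exp e2 * Real.exp e3)) := by ring
    _ = _ := by rw [G]; ring

lemma nuWeight_pos (β : ℝ) (K : Site d → ℝ) (Λ : Finset (Site d)) (τ : Config d)
    (σ : ↥Λ → Spin) : 0 < nuWeight β K Λ τ σ :=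
  Finset.prod_pos fun k _ => mul_pos (Real.cosh_pos _) (Real.exp_pos _)

lemma nuWeight_eq_rW (β : ℝ) (K : Site d → ℝ) (T Λ : Finset (Site d))
    (hT : ∀ k ∈ Λ, ∀ j, K (k - j) ≠ 0 → j ∈ T) (σ : ↥Λ → Spin) :
    nuWeight β K Λ (cPlus d) σ = rW β K T Λ (fun j => (patch Λ σ (cPlus d) j : ℝ)) := by
  unfold nuWeight rW
  rw [Real.exp_sum, ← Finset.prod_mul_distrib, ← Finset.prod_coe_sort Λ]
  refine Finset.prod_congr rfl fun k _ => ?_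
  congr 1
  · congr 2
    refine finsum_eq_sum_of_support_subset _ fun j hj => ?_
    exact hT k k.2 j (left_ne_zero_of_mul hj)
  · congr 2
    · simp [patch]
    · rw [finsum_mem_def]
      rw [finsum_eq_sum_of_support_subset (s := T \ Λ)]
      · refine Finset.sum_congr rfl fun j hj => ?_
        rw [Set.indicator_of_mem (by simpa using (Finset.mem_sdiff.1 hj).2)]
        simp [cPlus, sPlus]
      · intro j hj
        have hj' := Set.mem_of_indicator_ne_zero hj
        rw [Function.mem_support, Set.indicator_of_mem hj'] at hj
        simp only [Finset.coe_sdiff]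
        exact ⟨hT k k.2 j (left_ne_zero_of_mul hj), by simpa using hj'⟩

lemma exists_window (K : Site d → ℝ) (R : ℕ) (hK : SymmFiniteRange K R) (Λ : Finset (Site d)) :
    ∃ T : Finset (Site d), Λ ⊆ T ∧ ∀ k ∈ Λ, ∀ j, K (k - j) ≠ 0 → j ∈ T := by
  refine ⟨Λ ∪ Λ.biUnion fun k => (ball d R).image fun l => k - l, Finset.subset_union_left, ?_⟩
  intro k hk j hj
  refine Finset.mem_union_right _ (Finset.mem_biUnion.2 ⟨k, hk, Finset.mem_image.2
    ⟨k - j, ?_, by simp⟩⟩)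
  have h : ∑ i, |(k - j) i| ≤ (R : ℤ) := by
    by_contra h
    exact hj (hK.2 _ (not_le.1 h))
  simp only [ball, Finset.mem_filter, Finset.mem_Icc, Pi.le_def]
  have hi : ∀ i, |(k - j) i| ≤ (R : ℤ) := fun i =>
    (Finset.single_le_sum (f := fun i => |(k - j) i|) (fun _ _ => abs_nonneg _)
      (Finset.mem_univ i)).trans h
  exact ⟨⟨fun i => (abs_le.1 (hi i)).1, fun i => (abs_le.1 (hi i)).2⟩, h⟩

/-- The glued configuration on `Λ'`. -/
def glue (Λ Λ' : Finset (Site d)) (σout : ↥Λ' → Spin) (ζ : ↥Λ → Spin) : ↥Λ' → Spin :=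
  fun j => if h : (j : Site d) ∈ Λ then ζ ⟨j, h⟩ else σout j

lemma spin_le_one (s : Spin) : (s : ℝ) ≤ 1 := by
  have := s.2
  simp only [Finset.mem_insert, Finset.mem_singleton] at this
  rcases this with h | h <;> rw [h] <;> norm_num

lemma plus_part (β : ℝ) (hβ : 0 < β)
    (K : Site d → ℝ) (R : ℕ) (hK : SymmFiniteRange K R)
    (hKpos : ∀ k, 0 ≤ K k)
    (Λ Λ' : Finset (Site d)) (hsub : Λ ⊆ Λ')
    (σout : ↥Λ' → Spin) (f : (↥Λ → Spin) → ℝ) (hf : Monotone f) :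
    (∑ ζ : ↥Λ → Spin, (nuFV β K Λ' (cPlus d) (glue Λ Λ' σout ζ) /
        ∑ ζ' : ↥Λ → Spin, nuFV β K Λ' (cPlus d) (glue Λ Λ' σout ζ')) * f ζ)
      ≤ ∑ ζ, nuFV β K Λ (cPlus d) ζ * f ζ := by
  obtain ⟨T, hT1, hT2⟩ := exists_window K R hK Λ'
  haveI : Nonempty Spin := ⟨sPlus⟩
  have hZ : ∑ σ, nuWeight β K Λ' (cPlus d) σ ≠ 0 :=
    (Finset.sum_pos (fun a _ => nuWeight_pos β K Λ' _ a) Finset.univ_nonempty).ne'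
  have key := holley_norm (fun ζ => nuWeight β K Λ' (cPlus d) (glue Λ Λ' σout ζ))
    (fun ζ => nuWeight β K Λ (cPlus d) ζ) f (fun _ => nuWeight_pos _ _ _ _ _)
    (fun _ => nuWeight_pos _ _ _ _ _) hf (by
      intro a b
      rw [nuWeight_eq_rW β K T Λ' hT2, nuWeight_eq_rW β K T Λ' hT2,
        nuWeight_eq_rW β K T Λ (fun k hk => hT2 k (hsub hk)),
        nuWeight_eq_rW β K T Λ (fun k hk => hT2 k (hsub hk))]
      apply rW_le β hβ K hK.1 hKpos T Λ Λ' hsub hT1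
      · intro j
        by_cases hj : j ∈ Λ
        · have hj' := hsub hj
          simp only [patch, glue, hj, hj', dif_pos, Pi.inf_apply, Pi.sup_apply]
          rcases le_total (a ⟨j, hj⟩) (b ⟨j, hj⟩) with h | h
          · rw [inf_eq_left.2 h, sup_eq_right.2 h]
          · rw [inf_eq_right.2 h, sup_eq_left.2 h, add_comm]
        · by_cases hj' : j ∈ Λ' <;> simp [patch, glue, hj, hj']
      · intro j
        by_cases hj : j ∈ Λ
        · have hj' := hsub hj
          simp only [patch, glue, hj, hj', dif_pos, Pi.inf_apply]
          exact (inf_le_left : a ⟨j, hj⟩ ⊓ b ⟨j, hj⟩ ≤ _)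
        · by_cases hj' : j ∈ Λ' <;> simp [patch, glue, hj, hj']
      · intro j
        by_cases hj : j ∈ Λ
        · have hj' := hsub hj
          simp only [patch, glue, hj, hj', dif_pos, Pi.inf_apply]
          exact (inf_le_right : a ⟨j, hj⟩ ⊓ b ⟨j, hj⟩ ≤ _)
        · have : ((patch Λ b (cPlus d) j : Spin) : ℝ) = 1 := by simp [patch, hj, cPlus, sPlus]
          rw [this]
          exact spin_le_one _
      · intro j hj
        by_cases hj' : j ∈ Λ' <;> simp [patch, glue, hj, hj'])
  have e : ∀ ζ : ↥Λ → Spin, nuFV β K Λ' (cPlus d) (glue Λ Λ' σout ζ) /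
        ∑ ζ' : ↥Λ → Spin, nuFV β K Λ' (cPlus d) (glue Λ Λ' σout ζ') =
      nuWeight β K Λ' (cPlus d) (glue Λ Λ' σout ζ) /
        ∑ ζ' : ↥Λ → Spin, nuWeight β K Λ' (cPlus d) (glue Λ Λ' σout ζ') := by
    intro ζ
    unfold nuFV
    rw [← Finset.sum_div, div_div_div_cancel_right₀ hZ]
  simp only [e]
  exact key

/-- Spin flip. -/
def sneg (s : Spin) : Spin := ⟨-(s : ℝ), by
  have := s.2
  simp only [Finset.mem_insert, Finset.mem_singleton] at this ⊢
  rcases this with h | h <;> rw [h] <;> norm_num⟩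

lemma sneg_sneg (s : Spin) : sneg (sneg s) = s := Subtype.ext (neg_neg _)

/-- Flip of all the spins. -/
def flip {ι : Type*} : (ι → Spin) ≃ (ι → Spin) where
  toFun σ := fun i => sneg (σ i)
  invFun σ := fun i => sneg (σ i)
  left_inv σ := funext fun _ => sneg_sneg _
  right_inv σ := funext fun _ => sneg_sneg _

lemma nuWeight_flip (β : ℝ) (K : Site d → ℝ) (Λ : Finset (Site d)) (σ : ↥Λ → Spin) :
    nuWeight β K Λ (cMinus d) (flip σ) = nuWeight β K Λ (cPlus d) σ := by
  unfold nuWeight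
  refine Finset.prod_congr rfl fun k _ => ?_
  congr 1
  · rw [← Real.cosh_neg, ← mul_neg, ← finsum_neg_distrib]
    congr 2
    refine finsum_congr fun j => ?_
    by_cases hj : j ∈ Λ <;> simp [patch, flip, hj, sneg, cMinus, cPlus, sPlus, sMinus]
  · congr 1
    have : ∀ j : Site d, K (k - j) * ((cMinus d j : Spin) : ℝ) =
      - (K (k - j) * ((cPlus d j : Spin) : ℝ)) := by
      intro j; simp [cMinus, cPlus, sPlus, sMinus]
    simp only [this, finsum_neg_distrib]
    simp [flip, sneg]

lemma nuFV_flip (β : ℝ) (K : Site d → ℝ) (Λ : Finset (Site d)) (σ : ↥Λ → Spin) :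
    nuFV β K Λ (cMinus d) (flip σ) = nuFV β K Λ (cPlus d) σ := by
  unfold nuFV
  rw [nuWeight_flip, ← Equiv.sum_comp flip]
  simp only [nuWeight_flip]

lemma glue_flip (Λ Λ' : Finset (Site d)) (σout : ↥Λ' → Spin) (ζ : ↥Λ → Spin) :
    glue Λ Λ' σout (flip ζ) = flip (glue Λ Λ' (flip σout) ζ) := by
  funext j
  by_cases hj : (j : Site d) ∈ Λ
  · simp [glue, flip, hj]
  · simp [glue, flip, hj, sneg_sneg]

end ClassC

open ClassC in
/-- inequality (CondPlus): for `Λ ⊆ Λ'` and any configuration on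
`Λ'∖Λ`, the conditional law of `ν_{Λ'}^{+}` on `Λ` is stochastically below `ν_Λ^{+}`,
and the conditional law of `ν_{Λ'}^{−}` on `Λ` is stochastically above `ν_Λ^{−}`. -/
theorem stmt_12
    (d : ℕ) (hd : 1 ≤ d) (β : ℝ) (hβ : 0 < β)
    (K : Site d → ℝ) (R : ℕ) (hR : 1 ≤ R) (hK : SymmFiniteRange K R)
    (hKpos : ∀ k, 0 ≤ K k)
    (Λ Λ' : Finset (Site d)) (hsub : Λ ⊆ Λ')
    -- the configuration `σ_{Λ'∖Λ}` (only its values outside `Λ` matter)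
    (σout : ↥Λ' → Spin) :
    ∀ f : (↥Λ → Spin) → ℝ, Monotone f →
      (∑ ζ : ↥Λ → Spin,
          (nuFV β K Λ' (cPlus d)
              (fun j => if h : (j : Site d) ∈ Λ then ζ ⟨j, h⟩ else σout j) /
            ∑ ζ' : ↥Λ → Spin, nuFV β K Λ' (cPlus d)
              (fun j => if h : (j : Site d) ∈ Λ then ζ' ⟨j, h⟩ else σout j)) * f ζ)
        ≤ ∑ ζ, nuFV β K Λ (cPlus d) ζ * f ζ ∧
      (∑ ζ, nuFV β K Λ (cMinus d) ζ * f ζ)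
        ≤ ∑ ζ : ↥Λ → Spin,
          (nuFV β K Λ' (cMinus d)
              (fun j => if h : (j : Site d) ∈ Λ then ζ ⟨j, h⟩ else σout j) /
            ∑ ζ' : ↥Λ → Spin, nuFV β K Λ' (cMinus d)
              (fun j => if h : (j : Site d) ∈ Λ then ζ' ⟨j, h⟩ else σout j)) * f ζ := by
  intro f hf
  refine ⟨plus_part β hβ K R hK hKpos Λ Λ' hsub σout f hf, ?_⟩
  have key := plus_part β hβ K R hK hKpos Λ Λ' hsub (ClassC.flip σout)
    (fun ζ => - f (ClassC.flip ζ)) (by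
      intro a b hab
      refine neg_le_neg (hf fun i => ?_)
      have h : (a i : ℝ) ≤ b i := hab i
      have h2 : -(b i : ℝ) ≤ -(a i : ℝ) := neg_le_neg h
      exact h2)
  change _ ≤ ∑ ζ : ↥Λ → Spin, (nuFV β K Λ' (cMinus d) (glue Λ Λ' σout ζ) /
        ∑ ζ' : ↥Λ → Spin, nuFV β K Λ' (cMinus d) (glue Λ Λ' σout ζ')) * f ζ
  rw [← Equiv.sum_comp (ClassC.flip (ι := ↥Λ)),
    ← Equiv.sum_comp (ClassC.flip (ι := ↥Λ))
      (fun ζ => (nuFV β K Λ' (cMinus d) (glue Λ Λ' σout ζ) / _) * f ζ),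
    ← Equiv.sum_comp (ClassC.flip (ι := ↥Λ))
      (fun ζ => nuFV β K Λ' (cMinus d) (glue Λ Λ' σout ζ))]
  simp only [glue_flip, nuFV_flip]
  simp only [mul_neg, Finset.sum_neg_distrib] at key
  exact neg_le_neg_iff.1 key
end

section
/- (Comparison of finite-volume Gibbs and stationary measures with extremal boundary conditions.) Let d ≥ 1, β > 0 and K : ℤ^d → ℝ symmetric with finite range and K ≥ 0. Then for every finite Λ ⊂ ℤ^d: μ_Λ^{+} ≼ ν_Λ^{+} and ν_Λ^{−} ≼ μ_Λ^{−} in stochastic order on {−1,+1}^Λ, where superscript + (resp. −) denotes the constant boundary condition +1 (resp. −1). -/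
open MeasureTheory ProbabilityTheory

namespace ClassC

lemma fkg_real {α : Type*} [DistribLattice α] [Fintype α] (w f g : α → ℝ) (hw : ∀ a, 0 < w a)
    (hl : ∀ a b, w a * w b ≤ w (a ⊓ b) * w (a ⊔ b)) (hf : Monotone f) (hg : Monotone g) :
    (∑ a, w a * f a) * ∑ a, w a * g a ≤ (∑ a, w a) * ∑ a, w a * (f a * g a) := by
  have key : ∀ h : α → ℝ, ∃ C : ℝ, ∀ a, 0 ≤ h a + C := fun h => by
    refine ⟨∑ a, |h a|, fun a => ?_⟩
    have := Finset.single_le_sum (f := fun a => |h a|) (fun i _ => abs_nonneg _) (Finset.mem_univ a)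
    have h2 := neg_abs_le (h a)
    linarith
  obtain ⟨C, hC⟩ := key f
  obtain ⟨D, hD⟩ := key g
  have := fkg (μ := w) (f := fun a => f a + C) (g := fun a => g a + D) (fun a => (hw a).le) hC hD
    (fun a b h => by simpa using hf h) (fun a b h => by simpa using hg h) hl
  have e1 : ∑ a, w a * (f a + C) = ∑ a, w a * f a + (∑ a, w a) * C := by
    rw [Finset.sum_mul, ← Finset.sum_add_distrib]; exact Finset.sum_congr rfl fun _ _ => by ring
  have e2 : ∑ a, w a * (g a + D) = ∑ a, w a * g a + (∑ a, w a) * D := by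
    rw [Finset.sum_mul, ← Finset.sum_add_distrib]; exact Finset.sum_congr rfl fun _ _ => by ring
  have e3 : ∑ a, w a * ((f a + C) * (g a + D)) = ∑ a, w a * (f a * g a) + (∑ a, w a * f a) * D
      + (∑ a, w a * g a) * C + (∑ a, w a) * (C * D) := by
    simp only [Finset.sum_mul, ← Finset.sum_add_distrib]
    exact Finset.sum_congr rfl fun _ _ => by ring
  rw [e1, e2, e3] at this
  nlinarith [this]

lemma tilt_mono {α : Type*} [DistribLattice α] [Fintype α] [Nonempty α] (w f g : α → ℝ)
    (hw : ∀ a, 0 < w a) (hg0 : ∀ a, 0 < g a)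
    (hl : ∀ a b, w a * w b ≤ w (a ⊓ b) * w (a ⊔ b)) (hf : Monotone f) (hg : Monotone g) :
    ∑ a, w a / (∑ b, w b) * f a ≤ ∑ a, w a * g a / (∑ b, w b * g b) * f a := by
  have h := fkg_real w f g hw hl hf hg
  have p1 : 0 < ∑ b, w b := Finset.sum_pos (fun a _ => hw a) Finset.univ_nonempty
  have p2 : 0 < ∑ b, w b * g b :=
    Finset.sum_pos (fun a _ => mul_pos (hw a) (hg0 a)) Finset.univ_nonempty
  simp only [div_mul_eq_mul_div, ← Finset.sum_div]
  rw [div_le_div_iff₀ p1 p2]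
  have e : ∑ a, w a * g a * f a = ∑ a, w a * (f a * g a) :=
    Finset.sum_congr rfl fun _ _ => by ring
  rw [e]; linarith

lemma tilt_anti {α : Type*} [DistribLattice α] [Fintype α] [Nonempty α] (w f g : α → ℝ)
    (hw : ∀ a, 0 < w a) (hg0 : ∀ a, 0 < g a)
    (hl : ∀ a b, w a * w b ≤ w (a ⊓ b) * w (a ⊔ b)) (hf : Monotone f) (hg : Antitone g) :
    ∑ a, w a * g a / (∑ b, w b * g b) * f a ≤ ∑ a, w a / (∑ b, w b) * f a := by
  have h := fkg_real w f (fun a => - g a) hw hl hf (fun a b hab => neg_le_neg (hg hab))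
  have p1 : 0 < ∑ b, w b := Finset.sum_pos (fun a _ => hw a) Finset.univ_nonempty
  have p2 : 0 < ∑ b, w b * g b :=
    Finset.sum_pos (fun a _ => mul_pos (hw a) (hg0 a)) Finset.univ_nonempty
  simp only [div_mul_eq_mul_div, ← Finset.sum_div]
  rw [div_le_div_iff₀ p2 p1]
  have e : ∑ a, w a * g a * f a = ∑ a, w a * (f a * g a) :=
    Finset.sum_congr rfl fun _ _ => by ring
  simp only [mul_neg, Finset.sum_neg_distrib] at h
  rw [e]; linarith

lemma cosh_lattice {a b p q : ℝ} (h : a + b = p + q) (h1 : p ≤ a) (h2 : p ≤ b) :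
    Real.cosh a * Real.cosh b ≤ Real.cosh p * Real.cosh q := by
  have e : ∀ x y : ℝ, Real.cosh x * Real.cosh y = (Real.cosh (x + y) + Real.cosh (x - y)) / 2 :=
    fun x y => by rw [Real.cosh_add, Real.cosh_sub]; ring
  rw [e, e, h]
  have : Real.cosh (a - b) ≤ Real.cosh (p - q) := by
    rw [Real.cosh_le_cosh, abs_le]
    have h3 : |p - q| = q - p := by rw [abs_sub_comm]; exact abs_of_nonneg (by linarith)
    rw [h3]; constructor <;> linarith
  linarith

lemma exp_div_cosh_mono (c : ℝ) {x y : ℝ} (h : x ≤ y) :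
    Real.exp x / Real.cosh (x + c) ≤ Real.exp y / Real.cosh (y + c) := by
  rw [div_le_div_iff₀ (Real.cosh_pos _) (Real.cosh_pos _), Real.cosh_eq, Real.cosh_eq,
    mul_div_assoc', mul_div_assoc', mul_add, mul_add, ← Real.exp_add, ← Real.exp_add,
    ← Real.exp_add, ← Real.exp_add]
  have e1 : x + (y + c) = y + (x + c) := by ring
  have e2 : Real.exp (x + -(y + c)) ≤ Real.exp (y + -(x + c)) := Real.exp_le_exp.2 (by linarith)
  rw [e1]; linarith

variable {d : ℕ}

/-- Contribution of the spins in `Λ` to the local field. -/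
noncomputable def fin (K : Site d → ℝ) (Λ : Finset (Site d)) (k : Site d) (σ : ↥Λ → Spin) : ℝ :=
  ∑ j : ↥Λ, K (k - j) * (σ j : ℝ)

/-- Contribution of the boundary condition to the local field. -/
noncomputable def fout (K : Site d → ℝ) (Λ : Finset (Site d)) (τ : Config d) (k : Site d) : ℝ :=
  ∑ᶠ j ∈ {j : Site d | j ∉ Λ}, K (k - j) * (τ j : ℝ)

lemma supp_finite {K : Site d → ℝ} {R : ℕ} (hK : SymmFiniteRange K R) :
    {k | K k ≠ 0}.Finite := by
  refine (Set.finite_Icc (fun _ => -(R : ℤ)) (fun _ : Fin d => (R : ℤ))).subset fun k hk => ?_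
  have h : ∑ i, |k i| ≤ (R : ℤ) := by
    by_contra h
    exact hk (hK.2 k (not_le.1 h))
  have h2 : ∀ i, |k i| ≤ (R : ℤ) := fun i =>
    (Finset.single_le_sum (f := fun i => |k i|) (fun i _ => abs_nonneg _)
      (Finset.mem_univ i)).trans h
  exact ⟨fun i => (abs_le.1 (h2 i)).1, fun i => (abs_le.1 (h2 i)).2⟩

lemma supp_finite_left {K : Site d → ℝ} {R : ℕ} (hK : SymmFiniteRange K R) (k : Site d) :
    {j | K (k - j) ≠ 0}.Finite :=
  (supp_finite hK).preimage (f := fun j => k - j) (fun a _ b _ h => by simpa using h)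

lemma supp_finite_right {K : Site d → ℝ} {R : ℕ} (hK : SymmFiniteRange K R)
    (Λ : Finset (Site d)) : {k | ∃ j ∈ Λ, K (k - j) ≠ 0}.Finite := by
  have : {k | ∃ j ∈ Λ, K (k - j) ≠ 0} = ⋃ j ∈ Λ, {k | K (k - j) ≠ 0} := by ext; simp
  rw [this]
  exact Set.Finite.biUnion Λ.finite_toSet fun j _ =>
    (supp_finite hK).preimage (f := fun k => k - j) (fun a _ b _ h => by simpa using h)

lemma field_split {K : Site d → ℝ} {R : ℕ} (hK : SymmFiniteRange K R)
    (Λ : Finset (Site d)) (τ : Config d) (k : Site d) (σ : ↥Λ → Spin) :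
    ∑ᶠ j : Site d, K (k - j) * ((patch Λ σ τ) j : ℝ) = fin K Λ k σ + fout K Λ τ k := by
  have hs : (Function.support fun j => K (k - j) * ((patch Λ σ τ) j : ℝ)).Finite :=
    (supp_finite_left hK k).subset fun j hj => left_ne_zero_of_mul hj
  rw [← finsum_mem_univ, ← Set.union_compl_self (Λ : Set (Site d)),
    finsum_mem_union' disjoint_compl_right (hs.subset Set.inter_subset_right)
    (hs.subset Set.inter_subset_right)]
  congr 1
  · rw [finsum_mem_coe_finset, fin, ← Finset.sum_coe_sort]
    refine Finset.sum_congr rfl fun j _ => ?_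
    simp [patch]
  · refine finsum_mem_congr rfl fun j hj => ?_
    have : j ∉ Λ := hj
    simp [patch, this]

lemma fin_mono {K : Site d → ℝ} (hKpos : ∀ k, 0 ≤ K k) (Λ : Finset (Site d)) (k : Site d) :
    Monotone (fin K Λ k) := fun _ _ h =>
  Finset.sum_le_sum fun j _ => mul_le_mul_of_nonneg_left (h j) (hKpos _)

lemma fin_modular (K : Site d → ℝ) (Λ : Finset (Site d)) (k : Site d) (a b : ↥Λ → Spin) :
    fin K Λ k a + fin K Λ k b = fin K Λ k (a ⊓ b) + fin K Λ k (a ⊔ b) := by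
  simp only [fin, ← Finset.sum_add_distrib, ← mul_add]
  refine Finset.sum_congr rfl fun j _ => ?_
  congr 1
  rcases le_total (a j) (b j) with h | h <;> simp [h, add_comm]

/-- The interacting region: sites in `Λ` or interacting with `Λ`. -/
noncomputable def reg {K : Site d → ℝ} {R : ℕ} (hK : SymmFiniteRange K R)
    (Λ : Finset (Site d)) : Finset (Site d) := (supp_finite_right hK Λ).toFinset ∪ Λ

/-- Product weight. -/
noncomputable def gw (β : ℝ) {K : Site d → ℝ} {R : ℕ} (hK : SymmFiniteRange K R)
    (Λ : Finset (Site d)) (τ : Config d) (σ : ↥Λ → Spin) : ℝ :=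
  ∏ k ∈ reg hK Λ, Real.cosh (β * (fin K Λ k σ + fout K Λ τ k))

/-- The tilting density. -/
noncomputable def tw (β s : ℝ) {K : Site d → ℝ} {R : ℕ} (hK : SymmFiniteRange K R)
    (Λ : Finset (Site d)) (τ : Config d) (σ : ↥Λ → Spin) : ℝ :=
  ∏ k ∈ reg hK Λ \ Λ, Real.exp (s * (β * fin K Λ k σ)) /
    Real.cosh (β * (fin K Λ k σ + fout K Λ τ k))

lemma gw_pos (β : ℝ) {K : Site d → ℝ} {R : ℕ} (hK : SymmFiniteRange K R)
    (Λ : Finset (Site d)) (τ : Config d) (σ : ↥Λ → Spin) : 0 < gw β hK Λ τ σ :=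
  Finset.prod_pos fun _ _ => Real.cosh_pos _

lemma tw_pos (β s : ℝ) {K : Site d → ℝ} {R : ℕ} (hK : SymmFiniteRange K R)
    (Λ : Finset (Site d)) (τ : Config d) (σ : ↥Λ → Spin) : 0 < tw β s hK Λ τ σ :=
  Finset.prod_pos fun _ _ => div_pos (Real.exp_pos _) (Real.cosh_pos _)

lemma gw_lattice {β : ℝ} (hβ : 0 < β) {K : Site d → ℝ} {R : ℕ} (hK : SymmFiniteRange K R)
    (hKpos : ∀ k, 0 ≤ K k) (Λ : Finset (Site d)) (τ : Config d) (a b : ↥Λ → Spin) :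
    gw β hK Λ τ a * gw β hK Λ τ b ≤ gw β hK Λ τ (a ⊓ b) * gw β hK Λ τ (a ⊔ b) := by
  simp only [gw, ← Finset.prod_mul_distrib]
  refine Finset.prod_le_prod (fun _ _ => (mul_pos (Real.cosh_pos _) (Real.cosh_pos _)).le)
    fun k _ => ?_
  have h := fin_modular K Λ k a b
  have h1 := fin_mono hKpos Λ k (inf_le_left : a ⊓ b ≤ a)
  have h2 := fin_mono hKpos Λ k (inf_le_right : a ⊓ b ≤ b)
  refine cosh_lattice ?_ ?_ ?_
  · linear_combination β * h
  · exact mul_le_mul_of_nonneg_left (by linarith) hβ.le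
  · exact mul_le_mul_of_nonneg_left (by linarith) hβ.le

lemma tw_mono {β : ℝ} (hβ : 0 < β) {K : Site d → ℝ} {R : ℕ} (hK : SymmFiniteRange K R)
    (hKpos : ∀ k, 0 ≤ K k) (Λ : Finset (Site d)) (τ : Config d) :
    Monotone (tw β 1 hK Λ τ) := fun a b hab => by
  refine Finset.prod_le_prod (fun _ _ => (div_pos (Real.exp_pos _) (Real.cosh_pos _)).le)
    fun k _ => ?_
  have := exp_div_cosh_mono (β * fout K Λ τ k)
    (mul_le_mul_of_nonneg_left (fin_mono hKpos Λ k hab) hβ.le)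
  simpa only [one_mul, mul_add] using this

lemma tw_anti {β : ℝ} (hβ : 0 < β) {K : Site d → ℝ} {R : ℕ} (hK : SymmFiniteRange K R)
    (hKpos : ∀ k, 0 ≤ K k) (Λ : Finset (Site d)) (τ : Config d) :
    Antitone (tw β (-1) hK Λ τ) := fun a b hab => by
  refine Finset.prod_le_prod (fun _ _ => (div_pos (Real.exp_pos _) (Real.cosh_pos _)).le)
    fun k _ => ?_
  have := exp_div_cosh_mono (-(β * fout K Λ τ k))
    (neg_le_neg (mul_le_mul_of_nonneg_left (fin_mono hKpos Λ k hab) hβ.le))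
  simp only [← neg_add, Real.cosh_neg] at this
  simpa only [neg_one_mul, mul_add] using this

lemma ham_eq (β : ℝ) {K : Site d → ℝ} {R : ℕ} (hK : SymmFiniteRange K R)
    (Λ : Finset (Site d)) (τ : Config d) : ∃ c : ℝ, 0 < c ∧ ∀ σ : ↥Λ → Spin,
    gw β hK Λ τ σ = c * Real.exp (-ham β K Λ τ σ) := by
  classical
  refine ⟨∏ k ∈ Λ \ (supp_finite_right hK Λ).toFinset, Real.cosh (β * fout K Λ τ k),
    Finset.prod_pos fun _ _ => Real.cosh_pos _, fun σ => ?_⟩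
  have h : ham β K Λ τ σ = ∑ k ∈ (supp_finite_right hK Λ).toFinset,
      -Real.log (Real.cosh (β * (fin K Λ k σ + fout K Λ τ k))) := by
    simp only [ham, field_split hK]
    exact finsum_mem_eq_finite_toFinset_sum _ (supp_finite_right hK Λ)
  rw [h, Finset.sum_neg_distrib, neg_neg, Real.exp_sum]
  simp only [Real.exp_log (Real.cosh_pos _)]
  have hreg : reg hK Λ = (Λ \ (supp_finite_right hK Λ).toFinset) ∪
      (supp_finite_right hK Λ).toFinset := by
    ext k; simp only [reg, Finset.mem_union, Finset.mem_sdiff]; tauto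
  rw [gw, hreg, Finset.prod_union Finset.sdiff_disjoint]
  congr 1
  refine Finset.prod_congr rfl fun k hk => ?_
  have h0 : fin K Λ k σ = 0 := by
    refine Finset.sum_eq_zero fun j _ => ?_
    simp only [Finset.mem_sdiff, Set.Finite.mem_toFinset, Set.mem_setOf_eq, not_exists,
      not_and, not_not] at hk
    rw [hk.2 j j.2, zero_mul]
  rw [h0, zero_add]

lemma nu_eq (β s : ℝ) {K : Site d → ℝ} {R : ℕ} (hK : SymmFiniteRange K R)
    (Λ : Finset (Site d)) (τ : Config d) (hτ : ∀ j, (τ j : ℝ) = s) (σ : ↥Λ → Spin) :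
    nuWeight β K Λ τ σ = gw β hK Λ τ σ * tw β s hK Λ τ σ := by
  classical
  have hsub : Λ ⊆ reg hK Λ := Finset.subset_union_right
  have h1 : ∀ k : ↥Λ, fout K Λ τ k = ∑ j ∈ reg hK Λ \ Λ, K (j - k) * s := fun k => by
    have e : ∀ j : Site d, K ((k : Site d) - j) = K (j - k) := fun j => by
      rw [← hK.1, neg_sub]
    simp only [fout, hτ, e]
    refine finsum_mem_eq_sum_of_inter_support_eq _ ?_
    ext j
    simp only [Set.mem_inter_iff, Set.mem_setOf_eq, Function.mem_support, Finset.coe_sdiff,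
      Set.mem_diff, Finset.mem_coe, reg, Finset.mem_union, Set.Finite.mem_toFinset]
    constructor
    · rintro ⟨a, b⟩
      exact ⟨⟨Or.inl ⟨k, k.2, left_ne_zero_of_mul b⟩, a⟩, b⟩
    · rintro ⟨⟨_, a⟩, b⟩
      exact ⟨a, b⟩
  have h2 : ∏ k : ↥Λ, Real.exp (β * (σ k : ℝ) * fout K Λ τ k) =
      ∏ k ∈ reg hK Λ \ Λ, Real.exp (s * (β * fin K Λ k σ)) := by
    rw [← Real.exp_sum, ← Real.exp_sum]
    congr 1
    simp only [h1, fin, Finset.mul_sum]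
    rw [Finset.sum_comm]
    exact Finset.sum_congr rfl fun _ _ => Finset.sum_congr rfl fun _ _ => by ring
  have h3 : nuWeight β K Λ τ σ = (∏ k : ↥Λ, Real.cosh (β * (fin K Λ k σ + fout K Λ τ k))) *
      ∏ k : ↥Λ, Real.exp (β * (σ k : ℝ) * fout K Λ τ k) := by
    rw [← Finset.prod_mul_distrib]
    simp only [nuWeight, field_split hK]
    rfl
  have h4 := Finset.prod_coe_sort Λ fun k => Real.cosh (β * (fin K Λ k σ + fout K Λ τ k))
  rw [h3, h2, h4, gw, tw, ← Finset.prod_sdiff hsub, Finset.prod_div_distrib]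
  have p : 0 < ∏ k ∈ reg hK Λ \ Λ, Real.cosh (β * (fin K Λ k σ + fout K Λ τ k)) :=
    Finset.prod_pos fun _ _ => Real.cosh_pos _
  field_simp

lemma gibbs_eq (β : ℝ) {K : Site d → ℝ} {R : ℕ} (hK : SymmFiniteRange K R)
    (Λ : Finset (Site d)) (τ : Config d) (σ : ↥Λ → Spin) :
    gibbsFV β K Λ τ σ = gw β hK Λ τ σ / ∑ σ', gw β hK Λ τ σ' := by
  obtain ⟨c, hc, h⟩ := ham_eq β hK Λ τ
  simp only [h, ← Finset.mul_sum, gibbsFV]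
  rw [mul_div_mul_left _ _ hc.ne']

end ClassC

open ClassC in
/-- comparison of finite-volume Gibbs and stationary measures with
extremal boundary conditions: `μ_Λ^{+} ≼ ν_Λ^{+}` and `ν_Λ^{−} ≼ μ_Λ^{−}`. -/
theorem stmt_13
    (d : ℕ) (hd : 1 ≤ d) (β : ℝ) (hβ : 0 < β)
    (K : Site d → ℝ) (R : ℕ) (hR : 1 ≤ R) (hK : SymmFiniteRange K R)
    (hKpos : ∀ k, 0 ≤ K k)
    (Λ : Finset (Site d)) :
    ∀ f : (↥Λ → Spin) → ℝ, Monotone f →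
      (∑ σ, gibbsFV β K Λ (cPlus d) σ * f σ ≤ ∑ σ, nuFV β K Λ (cPlus d) σ * f σ) ∧
        ∑ σ, nuFV β K Λ (cMinus d) σ * f σ ≤ ∑ σ, gibbsFV β K Λ (cMinus d) σ * f σ := by
  intro f hf
  haveI : Nonempty (↥Λ → Spin) := ⟨fun _ => sPlus⟩
  constructor
  · simp only [gibbs_eq β hK, nuFV, nu_eq β 1 hK Λ (cPlus d) (fun _ => rfl)]
    exact tilt_mono _ f _ (gw_pos β hK Λ _) (tw_pos β 1 hK Λ _) (gw_lattice hβ hK hKpos Λ _) hf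
      (tw_mono hβ hK hKpos Λ _)
  · simp only [gibbs_eq β hK, nuFV, nu_eq β (-1) hK Λ (cMinus d) (fun _ => rfl)]
    exact tilt_anti _ f _ (gw_pos β hK Λ _) (tw_pos β (-1) hK Λ _) (gw_lattice hβ hK hKpos Λ _) hf
      (tw_anti hβ hK hKpos Λ _)
end

section
/- (Lemma ImplicationLimites: weak mixing implies condition (A).) Let d ≥ 1, β > 0 and K : ℤ^d → ℝ symmetric with finite range R > 0 and K ≥ 0. Assume the weak mixing condition in finite-volume form: there exist C > 0 and M > 0 such that for every integer L ≥ 2, ∫ σ₀ dμ_{B_L}^{+} − ∫ σ₀ dμ_{B_L}^{−} ≤ C e^{−M L}. Then condition (A) holds: there exist C' > 0, M' > 0 and L₁ ∈ ℕ* such that for every integer L ≥ L₁, ∫ σ₀ dν_{B_L}^{+} − ∫ σ₀ dν_{B_L}^{−} ≤ C' e^{−M' L}. -/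
open MeasureTheory ProbabilityTheory

namespace ClassC

lemma cosh_four {x y u v : ℝ} (hs : x + y = u + v) (h1 : u ≤ x) (h2 : u ≤ y) :
    Real.cosh x * Real.cosh y ≤ Real.cosh u * Real.cosh v := by
  have e : ∀ a b : ℝ, Real.cosh a * Real.cosh b =
      (Real.cosh (a + b) + Real.cosh (a - b)) / 2 := by
    intro a b
    rw [Real.cosh_add, Real.cosh_sub]; ring
  rw [e, e, hs]
  have : Real.cosh (x - y) ≤ Real.cosh (u - v) := by
    rw [Real.cosh_le_cosh]
    rw [abs_le]
    have : |u - v| = v - u := by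
      rw [abs_sub_comm]; exact abs_of_nonneg (by linarith)
    rw [this]
    constructor <;> linarith
  linarith

lemma holley_ratio {α : Type*} [DistribLattice α] [Fintype α] (m f g : α → ℝ)
    (hm1 : ∀ a, -1 ≤ m a) (hm : Monotone m) (hf : ∀ a, 0 ≤ f a) (hg : ∀ a, 0 ≤ g a)
    (hF : 0 < ∑ a, f a) (hG : 0 < ∑ a, g a)
    (h : ∀ a b, f a * g b ≤ f (a ⊓ b) * g (a ⊔ b)) :
    (∑ a, f a * m a) / ∑ a, f a ≤ (∑ a, g a * m a) / ∑ a, g a := by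
  have key := holley (μ := fun a => m a + 1) (f := fun a => f a / ∑ a, f a)
    (g := fun a => g a / ∑ a, g a)
    (fun a => by have := hm1 a; simp only [Pi.zero_apply]; linarith)
    (fun a => div_nonneg (hf a) hF.le) (fun a => div_nonneg (hg a) hG.le)
    (fun a b hab => by have := hm hab; simp only; linarith)
    (by rw [← Finset.sum_div, ← Finset.sum_div, div_self hF.ne', div_self hG.ne'])
    (fun a b => by
      rw [div_mul_div_comm, div_mul_div_comm]
      exact div_le_div_of_nonneg_right (h a b) (mul_nonneg hF.le hG.le))
  have e : ∀ q : α → ℝ, 0 < ∑ a, q a → ∑ a, (m a + 1) * (q a / ∑ a, q a) =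
      (∑ a, q a * m a) / (∑ a, q a) + 1 := by
    intro q hq
    have : ∀ a, (m a + 1) * (q a / ∑ a, q a) = (q a * m a) / (∑ a, q a) + q a / ∑ a, q a := by
      intro a; ring
    simp only [this]
    rw [Finset.sum_add_distrib, ← Finset.sum_div, ← Finset.sum_div, div_self hq.ne']
  rw [e f hF, e g hG] at key
  linarith

lemma spin_cases (s : Spin) : s = sPlus ∨ s = sMinus := by
  obtain ⟨s, hs⟩ := s
  simp only [Finset.mem_insert, Finset.mem_singleton] at hs
  rcases hs with rfl | rfl
  · right; rfl
  · left; rfl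

lemma spin_ge (s : Spin) : (-1 : ℝ) ≤ s := by
  rcases spin_cases s with rfl | rfl <;> simp [sPlus, sMinus]

lemma spin_le (s : Spin) : s ≤ sPlus := by
  rcases spin_cases s with rfl | rfl
  · exact le_rfl
  · rw [← Subtype.coe_le_coe]; simp [sPlus, sMinus]

lemma spin_ge' (s : Spin) : sMinus ≤ s := by
  rw [← Subtype.coe_le_coe]; simpa [sMinus] using spin_ge s

lemma spin_inf_add_sup (a b : Spin) :
    ((a : ℝ) + b) = ((a ⊓ b : Spin) : ℝ) + ((a ⊔ b : Spin) : ℝ) := by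
  rcases le_total a b with h | h
  · rw [inf_eq_left.2 h, sup_eq_right.2 h]
  · rw [inf_eq_right.2 h, sup_eq_left.2 h, add_comm]

variable {d : ℕ}

/-- The local sum `∑ K(k-j) η_j`. -/
noncomputable def locS (K : Site d → ℝ) (k : Site d) (η : Config d) : ℝ :=
  ∑ᶠ j : Site d, K (k - j) * (η j : ℝ)

lemma finite_nbr {K : Site d → ℝ} (hfin : (Function.support K).Finite) (k : Site d) :
    {j : Site d | K (k - j) ≠ 0}.Finite :=
  Set.Finite.preimage (f := fun j => k - j) (fun a _ b _ h => by simpa using h) hfin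

lemma locS_eq {K : Site d → ℝ} (hfin : (Function.support K).Finite) (k : Site d)
    (η : Config d) :
    locS K k η = ∑ j ∈ (finite_nbr hfin k).toFinset, K (k - j) * (η j : ℝ) := by
  refine finsum_eq_sum_of_support_subset _ ?_
  intro j hj
  simp only [Set.Finite.coe_toFinset, Set.mem_ofPred_eq]
  exact left_ne_zero_of_mul hj

lemma locS_cosh {K : Site d → ℝ} (hfin : (Function.support K).Finite)
    (hpos : ∀ k, 0 ≤ K k) {β : ℝ} (hβ : 0 < β) (k : Site d) (A B : Config d) :
    Real.cosh (β * locS K k A) * Real.cosh (β * locS K k B) ≤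
      Real.cosh (β * locS K k (A ⊓ B)) * Real.cosh (β * locS K k (A ⊔ B)) := by
  apply cosh_four
  · rw [← mul_add, ← mul_add]
    congr 1
    simp only [locS_eq hfin]
    rw [← Finset.sum_add_distrib, ← Finset.sum_add_distrib]
    refine Finset.sum_congr rfl fun j _ => ?_
    rw [← mul_add, ← mul_add, spin_inf_add_sup]; rfl
  · refine mul_le_mul_of_nonneg_left ?_ hβ.le
    simp only [locS_eq hfin]
    exact Finset.sum_le_sum fun j _ => mul_le_mul_of_nonneg_left
      (Subtype.coe_le_coe.2 ((inf_le_left : (A ⊓ B) ≤ A) j)) (hpos _)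
  · refine mul_le_mul_of_nonneg_left ?_ hβ.le
    simp only [locS_eq hfin]
    exact Finset.sum_le_sum fun j _ => mul_le_mul_of_nonneg_left
      (Subtype.coe_le_coe.2 ((inf_le_right : (A ⊓ B) ≤ B) j)) (hpos _)

open Classical in
/-- Product of the cosh factors that see the small volume. -/
noncomputable def gW (β : ℝ) (K : Site d → ℝ) (Λ' Λ : Finset (Site d)) (η : Config d) : ℝ :=
  ∏ k ∈ Λ.filter (fun k => ∃ j ∈ Λ', K (k - j) ≠ 0), Real.cosh (β * locS K k η)

open Classical in
/-- The other factors of the weight. -/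
noncomputable def qW (β : ℝ) (K : Site d → ℝ) (Λ' Λ : Finset (Site d)) (τ : Config d)
    (σ : ↥Λ → Spin) : ℝ :=
  (∏ k ∈ Λ.filter (fun k => ¬ ∃ j ∈ Λ', K (k - j) ≠ 0),
      Real.cosh (β * locS K k (patch Λ σ τ))) *
    ∏ k : ↥Λ, Real.exp (β * (σ k : ℝ) *
      ∑ᶠ j ∈ {j : Site d | j ∉ Λ}, K ((k : Site d) - j) * (τ j : ℝ))

lemma nuWeight_eq (β : ℝ) (K : Site d → ℝ) (Λ' Λ : Finset (Site d)) (τ : Config d)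
    (σ : ↥Λ → Spin) :
    nuWeight β K Λ τ σ = qW β K Λ' Λ τ σ * gW β K Λ' Λ (patch Λ σ τ) := by
  classical
  unfold nuWeight qW gW
  rw [Finset.prod_mul_distrib]
  rw [Finset.prod_coe_sort Λ
    (fun k => Real.cosh (β * ∑ᶠ j : Site d, K (k - j) * ((patch Λ σ τ) j : ℝ)))]
  rw [← Finset.prod_filter_mul_prod_filter_not Λ (fun k => ∃ j ∈ Λ', K (k - j) ≠ 0)]
  simp only [locS]
  ring

lemma exp_ham_eq (β : ℝ) (K : Site d → ℝ) (Λ' Λ : Finset (Site d))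
    (hT : ∀ k, ∀ j ∈ Λ', K (k - j) ≠ 0 → k ∈ Λ) (τ : Config d) (σ : ↥Λ' → Spin) :
    Real.exp (-ham β K Λ' τ σ) = gW β K Λ' Λ (patch Λ' σ τ) := by
  classical
  have : ham β K Λ' τ σ = ∑ k ∈ Λ.filter (fun k => ∃ j ∈ Λ', K (k - j) ≠ 0),
      -Real.log (Real.cosh (β * locS K k (patch Λ' σ τ))) := by
    rw [← finsum_mem_coe_finset]
    unfold ham locS
    refine finsum_congr fun k => ?_
    refine finsum_congr_Prop ?_ (fun _ => rfl)
    simp only [Finset.coe_filter, Set.mem_ofPred_eq, eq_iff_iff]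
    constructor
    · rintro ⟨j, hj, h⟩
      exact ⟨hT k j hj h, j, hj, h⟩
    · exact fun h => h.2
  rw [this, ← Finset.sum_neg_distrib, Real.exp_sum]
  unfold gW
  refine Finset.prod_congr rfl fun k _ => ?_
  rw [neg_neg, Real.exp_log (Real.cosh_pos _)]

lemma gW_pos (β : ℝ) (K : Site d → ℝ) (Λ' Λ : Finset (Site d)) (η : Config d) :
    0 < gW β K Λ' Λ η := Finset.prod_pos fun _ _ => Real.cosh_pos _

lemma qW_pos (β : ℝ) (K : Site d → ℝ) (Λ' Λ : Finset (Site d)) (τ : Config d)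
    (σ : ↥Λ → Spin) : 0 < qW β K Λ' Λ τ σ :=
  mul_pos (Finset.prod_pos fun _ _ => Real.cosh_pos _)
    (Finset.prod_pos fun _ _ => Real.exp_pos _)

lemma gW_four {K : Site d → ℝ} (hfin : (Function.support K).Finite)
    (hpos : ∀ k, 0 ≤ K k) {β : ℝ} (hβ : 0 < β) (Λ' Λ : Finset (Site d)) (A B : Config d) :
    gW β K Λ' Λ A * gW β K Λ' Λ B ≤ gW β K Λ' Λ (A ⊓ B) * gW β K Λ' Λ (A ⊔ B) := by
  unfold gW
  rw [← Finset.prod_mul_distrib, ← Finset.prod_mul_distrib]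
  exact Finset.prod_le_prod
    (fun _ _ => mul_nonneg (Real.cosh_pos _).le (Real.cosh_pos _).le)
    (fun k _ => locS_cosh hfin hpos hβ k A B)

lemma qW_congr (β : ℝ) (K : Site d → ℝ) (Λ' Λ : Finset (Site d)) (τ : Config d)
    (hT' : ∀ k ∈ Λ', ∀ j, K (k - j) ≠ 0 → j ∈ Λ)
    (σ σ' : ↥Λ → Spin) (h : ∀ k : ↥Λ, (k : Site d) ∉ Λ' → σ k = σ' k) :
    qW β K Λ' Λ τ σ = qW β K Λ' Λ τ σ' := by
  classical
  unfold qW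
  congr 1
  · refine Finset.prod_congr rfl fun k hk => ?_
    have hk2 := (Finset.mem_filter.1 hk).2
    push Not at hk2
    congr 2
    refine finsum_congr fun j => ?_
    by_cases hj : j ∈ Λ'
    · rw [hk2 j hj, zero_mul, zero_mul]
    · congr 2
      unfold patch
      split_ifs with hjΛ
      · exact h ⟨j, hjΛ⟩ hj
      · rfl
  · refine Finset.prod_congr rfl fun k _ => ?_
    by_cases hk : (k : Site d) ∈ Λ'
    · have : ∑ᶠ j ∈ {j : Site d | j ∉ Λ}, K ((k : Site d) - j) * (τ j : ℝ) = 0 := by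
        refine finsum_mem_eq_zero_of_forall_eq_zero fun j hj => ?_
        have : K ((k : Site d) - j) = 0 := by
          by_contra hne
          exact hj (hT' k hk j hne)
        rw [this, zero_mul]
      rw [this, mul_zero, mul_zero]
    · rw [h k hk]

lemma patch_inf (Λ : Finset (Site d)) (a b : ↥Λ → Spin) (τ : Config d) :
    patch Λ (a ⊓ b) τ = patch Λ a τ ⊓ patch Λ b τ := by
  funext j
  simp only [patch, Pi.inf_apply]
  split_ifs <;> simp

lemma patch_sup (Λ : Finset (Site d)) (a b : ↥Λ → Spin) (τ : Config d) :
    patch Λ (a ⊔ b) τ = patch Λ a τ ⊔ patch Λ b τ := by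
  funext j
  simp only [patch, Pi.sup_apply]
  split_ifs <;> simp

open Classical in
/-- The Gibbs weight of the small volume, seen on the large one. -/
noncomputable def muW (β : ℝ) (K : Site d → ℝ) (Λ' Λ : Finset (Site d)) (τ : Config d)
    (σ : ↥Λ → Spin) : ℝ :=
  if ∀ k : ↥Λ, (k : Site d) ∉ Λ' → σ k = τ k then gW β K Λ' Λ (patch Λ σ τ) else 0

lemma muW_nonneg (β : ℝ) (K : Site d → ℝ) (Λ' Λ : Finset (Site d)) (τ : Config d)
    (σ : ↥Λ → Spin) : 0 ≤ muW β K Λ' Λ τ σ := by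
  unfold muW
  split_ifs
  · exact (gW_pos _ _ _ _ _).le
  · exact le_rfl

lemma muW_sum (β : ℝ) (K : Site d → ℝ) (Λ' Λ : Finset (Site d)) (hsub : Λ' ⊆ Λ)
    (hT : ∀ k, ∀ j ∈ Λ', K (k - j) ≠ 0 → k ∈ Λ) (τ : Config d)
    (F : (↥Λ → Spin) → ℝ) (F' : (↥Λ' → Spin) → ℝ)
    (hF : ∀ σ, F' σ = F (fun k => patch Λ' σ τ k)) :
    ∑ σ, Real.exp (-ham β K Λ' τ σ) * F' σ = ∑ σ, muW β K Λ' Λ τ σ * F σ := by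
  refine Finset.sum_of_injOn (fun σ => fun k : ↥Λ => patch Λ' σ τ k) ?_ ?_ ?_ ?_
  · intro σ _ σ' _ h
    funext k
    have := congrFun h ⟨k, hsub k.2⟩
    simpa [patch] using this
  · intro σ _; simp
  · intro σ _ hσ
    unfold muW
    rw [if_neg, zero_mul]
    intro hc
    apply hσ
    refine ⟨fun k => σ ⟨k, hsub k.2⟩, by simp, ?_⟩
    funext k
    simp only [patch]
    split_ifs with hk
    · rfl
    · exact (hc k hk).symm
  · intro σ _
    rw [hF, exp_ham_eq β K Λ' Λ hT]
    unfold muW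
    rw [if_pos]
    · congr 2
      funext j
      simp only [patch]
      by_cases hj : j ∈ Λ
      · simp [hj]
      · have : j ∉ Λ' := fun h => hj (hsub h)
        simp [hj, this]
    · intro k hk
      simp [patch, hk]

lemma atZero_gibbs (β : ℝ) (K : Site d → ℝ) (Λ' Λ : Finset (Site d)) (hsub : Λ' ⊆ Λ)
    (hT : ∀ k, ∀ j ∈ Λ', K (k - j) ≠ 0 → k ∈ Λ) (τ : Config d) (h0 : (0 : Site d) ∈ Λ') :
    atZero h0 (gibbsFV β K Λ' τ) =
      (∑ σ, muW β K Λ' Λ τ σ * (σ ⟨0, hsub h0⟩ : ℝ)) / ∑ σ, muW β K Λ' Λ τ σ := by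
  have h1 := muW_sum β K Λ' Λ hsub hT τ (fun σ => (σ ⟨0, hsub h0⟩ : ℝ))
    (fun σ => (σ ⟨0, h0⟩ : ℝ)) (fun σ => by simp [patch, h0])
  have h2 := muW_sum β K Λ' Λ hsub hT τ (fun _ => 1) (fun _ => 1) (fun σ => rfl)
  simp only [mul_one] at h2
  rw [← h1, ← h2, Finset.sum_div]
  unfold atZero gibbsFV
  exact Finset.sum_congr rfl fun σ _ => by ring

lemma muW_sum_pos (β : ℝ) (K : Site d → ℝ) (Λ' Λ : Finset (Site d)) (hsub : Λ' ⊆ Λ)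
    (hT : ∀ k, ∀ j ∈ Λ', K (k - j) ≠ 0 → k ∈ Λ) (τ : Config d) :
    0 < ∑ σ, muW β K Λ' Λ τ σ := by
  have h2 := muW_sum β K Λ' Λ hsub hT τ (fun _ => 1) (fun _ => 1) (fun σ => rfl)
  simp only [mul_one] at h2
  rw [← h2]
  exact Finset.sum_pos (fun _ _ => Real.exp_pos _) ⟨fun _ => sPlus, Finset.mem_univ _⟩

lemma atZero_nu (β : ℝ) (K : Site d → ℝ) (Λ : Finset (Site d)) (τ : Config d)
    (h0 : (0 : Site d) ∈ Λ) :
    atZero h0 (nuFV β K Λ τ) =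
      (∑ σ, nuWeight β K Λ τ σ * (σ ⟨0, h0⟩ : ℝ)) / ∑ σ, nuWeight β K Λ τ σ := by
  rw [Finset.sum_div]
  unfold atZero nuFV
  exact Finset.sum_congr rfl fun σ _ => by ring

lemma nu_sum_pos (β : ℝ) (K : Site d → ℝ) (Λ : Finset (Site d)) (τ : Config d) :
    0 < ∑ σ, nuWeight β K Λ τ σ :=
  Finset.sum_pos (fun _ _ => nuWeight_pos _ _ _ _ _) ⟨fun _ => sPlus, Finset.mem_univ _⟩

lemma nu_le_plus {K : Site d → ℝ} (hfin : (Function.support K).Finite)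
    (hpos : ∀ k, 0 ≤ K k) {β : ℝ} (hβ : 0 < β) (Λ' Λ : Finset (Site d))
    (hsub : Λ' ⊆ Λ) (hT : ∀ k, ∀ j ∈ Λ', K (k - j) ≠ 0 → k ∈ Λ)
    (hT' : ∀ k ∈ Λ', ∀ j, K (k - j) ≠ 0 → j ∈ Λ) (h0 : (0 : Site d) ∈ Λ') :
    atZero (hsub h0) (nuFV β K Λ (cPlus d)) ≤ atZero h0 (gibbsFV β K Λ' (cPlus d)) := by
  rw [atZero_gibbs β K Λ' Λ hsub hT, atZero_nu]
  refine holley_ratio (fun σ : ↥Λ → Spin => (σ ⟨0, hsub h0⟩ : ℝ)) _ _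
    (fun σ => spin_ge _) (fun σ σ' h => Subtype.coe_le_coe.2 (h _))
    (fun σ => (nuWeight_pos _ _ _ _ _).le) (muW_nonneg _ _ _ _ _)
    (nu_sum_pos _ _ _ _) (muW_sum_pos _ _ _ _ hsub hT _) ?_
  intro a b
  by_cases hb : ∀ k : ↥Λ, (k : Site d) ∉ Λ' → b k = cPlus d k
  · have hs : ∀ k : ↥Λ, (k : Site d) ∉ Λ' → (a ⊔ b) k = cPlus d k := fun k hk => by
      rw [Pi.sup_apply, hb k hk]; exact sup_eq_right.2 (spin_le _)
    have hi : ∀ k : ↥Λ, (k : Site d) ∉ Λ' → (a ⊓ b) k = a k := fun k hk => by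
      rw [Pi.inf_apply, hb k hk]; exact inf_eq_left.2 (spin_le _)
    unfold muW
    rw [if_pos hb, if_pos hs, nuWeight_eq β K Λ' Λ, nuWeight_eq β K Λ' Λ,
      qW_congr β K Λ' Λ _ hT' _ _ hi, patch_inf, patch_sup, mul_assoc, mul_assoc]
    exact mul_le_mul_of_nonneg_left (gW_four hfin hpos hβ _ _ _ _) (qW_pos _ _ _ _ _ _).le
  · have : muW β K Λ' Λ (cPlus d) b = 0 := if_neg hb
    rw [this, mul_zero]
    exact mul_nonneg (nuWeight_pos _ _ _ _ _).le (muW_nonneg _ _ _ _ _ _)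

lemma minus_le_nu {K : Site d → ℝ} (hfin : (Function.support K).Finite)
    (hpos : ∀ k, 0 ≤ K k) {β : ℝ} (hβ : 0 < β) (Λ' Λ : Finset (Site d))
    (hsub : Λ' ⊆ Λ) (hT : ∀ k, ∀ j ∈ Λ', K (k - j) ≠ 0 → k ∈ Λ)
    (hT' : ∀ k ∈ Λ', ∀ j, K (k - j) ≠ 0 → j ∈ Λ) (h0 : (0 : Site d) ∈ Λ') :
    atZero h0 (gibbsFV β K Λ' (cMinus d)) ≤ atZero (hsub h0) (nuFV β K Λ (cMinus d)) := by
  rw [atZero_gibbs β K Λ' Λ hsub hT, atZero_nu]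
  refine holley_ratio (fun σ : ↥Λ → Spin => (σ ⟨0, hsub h0⟩ : ℝ)) _ _
    (fun σ => spin_ge _) (fun σ σ' h => Subtype.coe_le_coe.2 (h _))
    (muW_nonneg _ _ _ _ _) (fun σ => (nuWeight_pos _ _ _ _ _).le)
    (muW_sum_pos _ _ _ _ hsub hT _) (nu_sum_pos _ _ _ _) ?_
  intro a b
  by_cases ha : ∀ k : ↥Λ, (k : Site d) ∉ Λ' → a k = cMinus d k
  · have hs : ∀ k : ↥Λ, (k : Site d) ∉ Λ' → (a ⊔ b) k = b k := fun k hk => by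
      rw [Pi.sup_apply, ha k hk]; exact sup_eq_right.2 (spin_ge' _)
    have hi : ∀ k : ↥Λ, (k : Site d) ∉ Λ' → (a ⊓ b) k = cMinus d k := fun k hk => by
      rw [Pi.inf_apply, ha k hk]; exact inf_eq_left.2 (spin_ge' _)
    unfold muW
    rw [if_pos ha, if_pos hi, nuWeight_eq β K Λ' Λ, nuWeight_eq β K Λ' Λ,
      qW_congr β K Λ' Λ _ hT' _ _ hs, patch_inf, patch_sup, mul_left_comm,
      mul_left_comm (gW β K Λ' Λ _)]
    exact mul_le_mul_of_nonneg_left (gW_four hfin hpos hβ _ _ _ _) (qW_pos _ _ _ _ _ _).le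
  · have : muW β K Λ' Λ (cMinus d) a = 0 := if_neg ha
    rw [this, zero_mul]
    exact mul_nonneg (muW_nonneg _ _ _ _ _ _) (nuWeight_pos _ _ _ _ _).le

lemma mem_ball' {L : ℕ} {k : Site d} : k ∈ ball d L ↔ ∑ i, |k i| ≤ (L : ℤ) := by
  unfold ball
  rw [Finset.mem_filter, and_iff_right_iff_imp]
  intro h
  have : ∀ i, |k i| ≤ (L : ℤ) := fun i =>
    (Finset.single_le_sum (f := fun i => |k i|) (fun i _ => abs_nonneg _)
      (Finset.mem_univ i)).trans h
  rw [Finset.mem_Icc]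
  exact ⟨fun i => (abs_le.1 (this i)).1, fun i => (abs_le.1 (this i)).2⟩

end ClassC

open ClassC in
/-- Lemma `ImplicationLimites`: weak mixing implies condition (A):
exponential decay of the boundary influence for the finite-volume Gibbs measures
implies exponential decay of the boundary influence for the finite-volume stationary
measures `ν_{B_L}^{±}`. -/
theorem stmt_15
    (d : ℕ) (hd : 1 ≤ d) (β : ℝ) (hβ : 0 < β)
    (K : Site d → ℝ) (R : ℕ) (hR : 1 ≤ R) (hK : SymmFiniteRange K R)
    (hKpos : ∀ k, 0 ≤ K k)
    (C M : ℝ) (hC : 0 < C) (hM : 0 < M)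
    (hWM : ∀ L : ℕ, 2 ≤ L →
      atZero (zero_mem_ball d L) (gibbsFV β K (ball d L) (cPlus d)) -
          atZero (zero_mem_ball d L) (gibbsFV β K (ball d L) (cMinus d)) ≤
        C * Real.exp (-M * L)) :
    ∃ C' > (0 : ℝ), ∃ M' > (0 : ℝ), ∃ L₁ : ℕ, 1 ≤ L₁ ∧
      ∀ L : ℕ, L₁ ≤ L →
        atZero (zero_mem_ball d L) (nuFV β K (ball d L) (cPlus d)) -
            atZero (zero_mem_ball d L) (nuFV β K (ball d L) (cMinus d)) ≤
          C' * Real.exp (-M' * L) := by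
  obtain ⟨hsym, hrange⟩ := hK
  have hnz : ∀ k, K k ≠ 0 → ∑ i, |k i| ≤ (R : ℤ) := fun k hk => by
    by_contra hc
    exact hk (hrange k (not_le.1 hc))
  have hfin : (Function.support K).Finite :=
    (ball d R).finite_toSet.subset fun k hk => mem_ball'.2 (hnz k hk)
  refine ⟨C * Real.exp (M * R), by positivity, M, hM, R + 2, by omega, ?_⟩
  intro L hL
  obtain ⟨n, rfl⟩ : ∃ n, L = n + R := ⟨L - R, by omega⟩
  have hsub : ball d n ⊆ ball d (n + R) := fun k hk => by
    rw [mem_ball'] at hk ⊢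
    push_cast; omega
  have hT : ∀ k, ∀ j ∈ ball d n, K (k - j) ≠ 0 → k ∈ ball d (n + R) := by
    intro k j hj hk
    rw [mem_ball'] at hj ⊢
    have h1 := hnz _ hk
    have h2 : ∑ i, |k i| ≤ ∑ i, |(k - j) i| + ∑ i, |j i| := by
      rw [← Finset.sum_add_distrib]
      refine Finset.sum_le_sum fun i _ => ?_
      have := abs_add_le ((k - j) i) (j i)
      simpa using this
    push_cast; omega
  have hT' : ∀ k ∈ ball d n, ∀ j, K (k - j) ≠ 0 → j ∈ ball d (n + R) := by
    intro k hk j hj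
    refine hT j k hk ?_
    rwa [← hsym, neg_sub]
  have h0 := zero_mem_ball d n
  have h1 := nu_le_plus hfin hKpos hβ _ _ hsub hT hT' h0
  have h2 := minus_le_nu hfin hKpos hβ _ _ hsub hT hT' h0
  have h3 := hWM n (by omega)
  have h4 : C * Real.exp (M * R) * Real.exp (-M * ((n + R : ℕ) : ℝ)) =
      C * Real.exp (-M * n) := by
    rw [mul_assoc, ← Real.exp_add]
    congr 2
    push_cast; ring
  rw [h4]
  linarith
end
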